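/- With B, C and E a regular separability idempotent with antipodal maps S_B, S_C as in the context, one has (S_B ⊗ S_C)(E) = τ(E), where τ : B ⊗ C → C ⊗ B is the tensor flip map. Consequently, the distinguished linear functionals satisfy φ_B = φ_C ∘ S_B and φ_C = φ_B ∘ S_C. -/

import Mathlib

open TensorProduct

/-- Slice map `id ⊗ ω` landing in the left tensor factor. -/
noncomputable def sL {B C : Type} [AddCommGroup B] [Module ℂ B] [AddCommGroup C] [Module ℂ C]
    (ω : C →ₗ[ℂ] ℂ) : (B ⊗[ℂ] C) →ₗ[ℂ] B :=
  (TensorProduct.rid ℂ B).toLinearMap ∘ₗ LinearMap.lTensor B ω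

/-- Slice map `ω ⊗ id` landing in the right tensor factor. -/
noncomputable def sR {B C : Type} [AddCommGroup B] [Module ℂ B] [AddCommGroup C] [Module ℂ C]
    (ω : B →ₗ[ℂ] ℂ) : (B ⊗[ℂ] C) →ₗ[ℂ] C :=
  (TensorProduct.lid ℂ C).toLinearMap ∘ₗ LinearMap.rTensor C ω

section SeparabilityIdempotent

variable {B C : Type} [Ring B] [Algebra ℂ B] [Ring C] [Algebra ℂ C]

@[simp]
theorem sL_tmul (ω : C →ₗ[ℂ] ℂ) (b : B) (c : C) : sL ω (b ⊗ₜ[ℂ] c) = ω c • b := by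
  simp [sL]

@[simp]
theorem sR_tmul (ω : B →ₗ[ℂ] ℂ) (b : B) (c : C) : sR ω (b ⊗ₜ[ℂ] c) = ω b • c := by
  simp [sR]

theorem sL_tmul_one_mul (ω : C →ₗ[ℂ] ℂ) (b : B) (X : B ⊗[ℂ] C) :
    sL ω ((b ⊗ₜ[ℂ] (1 : C)) * X) = b * sL ω X := by
  induction X with
  | zero => simp
  | tmul x y => simp
  | add X Y hX hY => simp [mul_add, hX, hY]

/-- Slicing both legs is independent of the order. -/
theorem apply_sR_eq_apply_sL (ω : B →ₗ[ℂ] ℂ) (η : C →ₗ[ℂ] ℂ) (X : B ⊗[ℂ] C) :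
    η (sR ω X) = ω (sL η X) := by
  induction X with
  | zero => simp
  | tmul x y => simp [mul_comm]
  | add X Y hX hY => simp [hX, hY]

theorem map_one_of_antimul {A D : Type} [Ring A] [Algebra ℂ A] [Ring D] [Algebra ℂ D]
    (S : A ≃ₗ[ℂ] D) (hS : ∀ a a' : A, S (a * a') = S a' * S a) : S 1 = 1 := by
  have h := hS (S.symm 1) 1
  simpa using h.symm

/-- The linear map `b ⊗ c ↦ S_C c ⊗ S_B b`. -/
noncomputable def flipAntipode (SB : B →ₗ[ℂ] C) (SC : C →ₗ[ℂ] B) :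
    B ⊗[ℂ] C →ₗ[ℂ] B ⊗[ℂ] C :=
  (TensorProduct.comm ℂ C B).toLinearMap ∘ₗ TensorProduct.map SB SC

@[simp]
theorem flipAntipode_tmul (SB : B →ₗ[ℂ] C) (SC : C →ₗ[ℂ] B) (b : B) (c : C) :
    flipAntipode SB SC (b ⊗ₜ[ℂ] c) = SC c ⊗ₜ[ℂ] SB b := by
  simp [flipAntipode]

theorem flipAntipode_mul (SB : B →ₗ[ℂ] C) (SC : C →ₗ[ℂ] B)
    (hSB : ∀ b b' : B, SB (b * b') = SB b' * SB b)
    (hSC : ∀ c c' : C, SC (c * c') = SC c' * SC c) (X Y : B ⊗[ℂ] C) :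
    flipAntipode SB SC (X * Y) = flipAntipode SB SC Y * flipAntipode SB SC X := by
  induction X with
  | zero => simp
  | add X X' hX hX' => simp [add_mul, mul_add, hX, hX']
  | tmul x y =>
    induction Y with
    | zero => simp
    | add Y Y' hY hY' => simp [add_mul, mul_add, hY, hY']
    | tmul x' y' => simp [hSB, hSC]

/-- The linear map `b ⊗ c ↦ b * S_C c`. -/
noncomputable def mulAntipode (SC : C →ₗ[ℂ] B) : B ⊗[ℂ] C →ₗ[ℂ] B :=
  LinearMap.mul' ℂ B ∘ₗ LinearMap.lTensor B SC

@[simp]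
theorem mulAntipode_tmul (SC : C →ₗ[ℂ] B) (b : B) (c : C) :
    mulAntipode SC (b ⊗ₜ[ℂ] c) = b * SC c := by
  simp [mulAntipode]

theorem mul_eq_mulAntipode_tmul_one_mul (SC : C →ₗ[ℂ] B) (G : B ⊗[ℂ] C)
    (hG : ∀ c : C, ((1 : B) ⊗ₜ[ℂ] c) * G = (SC c ⊗ₜ[ℂ] (1 : C)) * G) (X : B ⊗[ℂ] C) :
    X * G = (mulAntipode SC X ⊗ₜ[ℂ] (1 : C)) * G := by
  induction X with
  | zero => simp
  | add X Y hX hY => rw [add_mul, hX, hY, map_add, TensorProduct.add_tmul, add_mul]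
  | tmul b c =>
    have h : b ⊗ₜ[ℂ] c = (b ⊗ₜ[ℂ] (1 : C)) * ((1 : B) ⊗ₜ[ℂ] c) := by simp
    rw [h, mul_assoc, hG, ← mul_assoc]
    simp

theorem mul_flipAntipode (SB : B →ₗ[ℂ] C) (SC : C →ₗ[ℂ] B) (G : B ⊗[ℂ] C)
    (hG : ∀ b : B, G * (b ⊗ₜ[ℂ] (1 : C)) = G * ((1 : B) ⊗ₜ[ℂ] SB b)) (X : B ⊗[ℂ] C) :
    G * flipAntipode SB SC X = G * (mulAntipode SC X ⊗ₜ[ℂ] (1 : C)) := by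
  induction X with
  | zero => simp
  | add X Y hX hY => rw [map_add, mul_add, hX, hY, map_add, TensorProduct.add_tmul, mul_add]
  | tmul b c =>
    have h : SC c ⊗ₜ[ℂ] SB b = ((1 : B) ⊗ₜ[ℂ] SB b) * (SC c ⊗ₜ[ℂ] (1 : C)) := by simp
    rw [flipAntipode_tmul, h, ← mul_assoc, ← hG, mul_assoc]
    simp

theorem sL_flipAntipode (SB : B →ₗ[ℂ] C) (SC : C →ₗ[ℂ] B) (ω : C →ₗ[ℂ] ℂ) (X : B ⊗[ℂ] C) :
    sL ω (flipAntipode SB SC X) = SC (sR (ω ∘ₗ SB) X) := by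
  induction X with
  | zero => simp
  | tmul x y => simp
  | add X Y hX hY => simp [hX, hY]

theorem sR_flipAntipode (SB : B →ₗ[ℂ] C) (SC : C →ₗ[ℂ] B) (ω : B →ₗ[ℂ] ℂ) (X : B ⊗[ℂ] C) :
    sR ω (flipAntipode SB SC X) = SB (sL (ω ∘ₗ SC) X) := by
  induction X with
  | zero => simp
  | tmul x y => simp
  | add X Y hX hY => simp [hX, hY]

/-- If the left leg of `E` is all of `B`, then `ω ↦ (ω ⊗ id) E` is injective. -/
theorem eq_of_sR_eq {E : B ⊗[ℂ] C}
    (hfull : Submodule.span ℂ {x : B | ∃ ω : C →ₗ[ℂ] ℂ, x = sL ω E} = ⊤)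
    {ω ω' : B →ₗ[ℂ] ℂ} (h : sR ω E = sR ω' E) : ω = ω' := by
  refine LinearMap.ext_on hfull ?_
  rintro _ ⟨η, rfl⟩
  rw [← apply_sR_eq_apply_sL, ← apply_sR_eq_apply_sL, h]

/-- If the right leg of `E` is all of `C`, then `ω ↦ (id ⊗ ω) E` is injective. -/
theorem eq_of_sL_eq {E : B ⊗[ℂ] C}
    (hfull : Submodule.span ℂ {y : C | ∃ ω : B →ₗ[ℂ] ℂ, y = sR ω E} = ⊤)
    {ω ω' : C →ₗ[ℂ] ℂ} (h : sL ω E = sL ω' E) : ω = ω' := by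
  refine LinearMap.ext_on hfull ?_
  rintro _ ⟨η, rfl⟩
  rw [apply_sR_eq_apply_sL, apply_sR_eq_apply_sL, h]

end SeparabilityIdempotent

theorem statement4
    (B C : Type) [Ring B] [Algebra ℂ B] [Ring C] [Algebra ℂ C]
    (E : B ⊗[ℂ] C) (hEE : E * E = E)
    (hfullB : Submodule.span ℂ {x : B | ∃ ω : C →ₗ[ℂ] ℂ, x = sL ω E} = ⊤)
    (hfullC : Submodule.span ℂ {y : C | ∃ ω : B →ₗ[ℂ] ℂ, y = sR ω E} = ⊤)
    (SB : B ≃ₗ[ℂ] C) (SC : C ≃ₗ[ℂ] B)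
    (hSBanti : ∀ b b' : B, SB (b * b') = SB b' * SB b)
    (hSCanti : ∀ c c' : C, SC (c * c') = SC c' * SC c)
    (hSBrel : ∀ b : B, E * (b ⊗ₜ[ℂ] (1 : C)) = E * ((1 : B) ⊗ₜ[ℂ] SB b))
    (hSCrel : ∀ c : C, ((1 : B) ⊗ₜ[ℂ] c) * E = (SC c ⊗ₜ[ℂ] (1 : C)) * E)
    (φB : B →ₗ[ℂ] ℂ) (hφB : sR φB E = (1 : C))
    (φC : C →ₗ[ℂ] ℂ) (hφC : sL φC E = (1 : B)) :
    TensorProduct.map SB.toLinearMap SC.toLinearMap E = TensorProduct.comm ℂ B C E ∧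
    (∀ b : B, φB b = φC (SB b)) ∧
    (∀ c : C, φC c = φB (SC c)) := by
  have hSB1 := map_one_of_antimul SB hSBanti
  have hSC1 := map_one_of_antimul SC hSCanti
  have hmul : mulAntipode SC.toLinearMap E = 1 := by
    have h := mul_eq_mulAntipode_tmul_one_mul SC.toLinearMap E hSCrel E
    rw [hEE] at h
    have h' := congrArg (sL φC) h
    rw [sL_tmul_one_mul, hφC, mul_one] at h'
    exact h'.symm
  have hflip : flipAntipode SB.toLinearMap SC.toLinearMap E = E := by
    set F := flipAntipode SB.toLinearMap SC.toLinearMap E with hF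
    have hFrel : ∀ c : C, ((1 : B) ⊗ₜ[ℂ] c) * F = (SC c ⊗ₜ[ℂ] (1 : C)) * F := by
      intro c
      have h := congrArg (flipAntipode SB.toLinearMap SC.toLinearMap) (hSBrel (SB.symm c))
      rw [flipAntipode_mul _ _ hSBanti hSCanti, flipAntipode_mul _ _ hSBanti hSCanti, ← hF] at h
      simpa [hSB1, hSC1] using h
    have h₁ : E * F = F := by
      rw [mul_eq_mulAntipode_tmul_one_mul SC.toLinearMap F hFrel E, hmul,
        ← Algebra.TensorProduct.one_def, one_mul]
    have h₂ : E * F = E := by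
      rw [hF, mul_flipAntipode _ _ E hSBrel, hmul, ← Algebra.TensorProduct.one_def, mul_one]
    exact h₁.symm.trans h₂
  refine ⟨?_, ?_, ?_⟩
  · conv_rhs => rw [← hflip]
    simp [flipAntipode]
  · refine LinearMap.congr_fun (eq_of_sR_eq hfullB (ω' := φC ∘ₗ SB.toLinearMap) ?_)
    apply SC.injective
    have h := sL_flipAntipode SB.toLinearMap SC.toLinearMap φC E
    rw [hflip, hφC] at h
    rw [hφB, hSC1]
    exact h
  · refine LinearMap.congr_fun (eq_of_sL_eq hfullC (ω' := φB ∘ₗ SC.toLinearMap) ?_)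
    apply SB.injective
    have h := sR_flipAntipode SB.toLinearMap SC.toLinearMap φB E
    rw [hflip, hφB] at h
    rw [hφC, hSB1]
    exact h
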